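/- arXiv:2204.08268 — 2 statements merged into one kernel-verified Lean document; each statement's English description precedes it below -/
import Mathlib

section
/- Let θ be an irrational real number, let q be a positive integer, and let p be an integer such that |mθ − T| ≥ |qθ − p| for all integers T and all integers m with 1 ≤ m < q. Then for every real number c, the set of integers M with 1 ≤ M < q for which there exists an integer T with |Mθ − T − c| ≤ |qθ − p| / 2 has at most 2 elements. -/
theorem stmt16
    (θ : ℝ) (hθ : Irrational θ)
    (q : ℤ) (hq : 0 < q) (p : ℤ)
    (hbest : ∀ (T m : ℤ), 1 ≤ m → m < q →
      |(q : ℝ) * θ - (p : ℝ)| ≤ |(m : ℝ) * θ - (T : ℝ)|) :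
    ∀ c : ℝ,
      {M : ℤ | 1 ≤ M ∧ M < q ∧
        ∃ T : ℤ, |(M : ℝ) * θ - (T : ℝ) - c| ≤ |(q : ℝ) * θ - (p : ℝ)| / 2}.Finite ∧
      {M : ℤ | 1 ≤ M ∧ M < q ∧
        ∃ T : ℤ, |(M : ℝ) * θ - (T : ℝ) - c| ≤ |(q : ℝ) * θ - (p : ℝ)| / 2}.ncard ≤ 2 := by
  intro c
  have hfin : {M : ℤ | 1 ≤ M ∧ M < q ∧
      ∃ T : ℤ, |(M : ℝ) * θ - (T : ℝ) - c| ≤ |(q : ℝ) * θ - (p : ℝ)| / 2}.Finite :=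
    (Set.finite_Ico 1 q).subset fun M hM => ⟨hM.1, hM.2.1⟩
  refine ⟨hfin, ?_⟩
  have hpos : 0 < |(q : ℝ) * θ - (p : ℝ)| :=
    abs_pos.2 (((hθ.intCast_mul hq.ne').sub_intCast p).ne_zero)
  have sep : ∀ M N S T : ℤ, 1 ≤ M → M < q → 1 ≤ N → N < q → M ≠ N →
      |(q : ℝ) * θ - (p : ℝ)| ≤ |((M : ℝ) * θ - S - c) - ((N : ℝ) * θ - T - c)| := by
    intro M N S T hM hMq hN hNq hne
    rcases lt_or_gt_of_ne hne with h | h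
    · have := hbest (T - S) (N - M) (by lia) (by lia)
      rw [abs_sub_comm ((M : ℝ) * θ - S - c)]
      convert this using 2
      push_cast
      ring
    · have := hbest (S - T) (M - N) (by lia) (by lia)
      convert this using 2
      push_cast
      ring
  by_contra! hcard
  obtain ⟨M₁, ⟨h₁, h₁q, T₁, hT₁⟩, M₂, ⟨h₂, h₂q, T₂, hT₂⟩, M₃, ⟨h₃, h₃q, T₃, hT₃⟩, h12, h13, h23⟩ :=
    (Set.two_lt_ncard hfin).1 hcard
  have d12 := sep M₁ M₂ T₁ T₂ h₁ h₁q h₂ h₂q h12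
  have d13 := sep M₁ M₃ T₁ T₃ h₁ h₁q h₃ h₃q h13
  have d23 := sep M₂ M₃ T₂ T₃ h₂ h₂q h₃ h₃q h23
  rw [abs_le] at hT₁ hT₂ hT₃
  rw [le_abs'] at d12 d13 d23
  rcases d12 with d12 | d12 <;> rcases d13 with d13 | d13 <;> rcases d23 with d23 | d23 <;>
    linarith
end

section
/- Let θ be a positive irrational real number with continued fraction convergents p_N/q_N, let k ≥ 1 be an integer, let 0 = r_0 < r_1 < ⋯ < r_k < r_{k+1} = 1 be real numbers, and set η := min_{0 ≤ i ≤ k} (r_{i+1} − r_i). For n ∈ ℕ define δ(n) ∈ {0,1}^{k+1} by δ(n)_i = 1 if the fractional part {nθ} lies in [r_i, r_{i+1}] and δ(n)_i = 0 otherwise. Let w ≥ 1 be an integer and let N be such that q_N > 2(w+1)/η. Then the set I_w(N) := { M : 1 ≤ M < q_N and δ(M + ℓ_1 q_N) ≠ δ(M + ℓ_2 q_N) for some integers 0 ≤ ℓ_1 < ℓ_2 ≤ w } has at most 2k(w+1) elements. -/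
/-- If a breakpoint partition of `[0, 1]` codes two reals differently (through their fractional
parts), then some integer translate of a breakpoint lies between them. -/
theorem exists_breakpoint_mem_Icc {k : ℕ} {r : ℕ → ℝ} (hr0 : r 0 = 0) (hrtop : r (k + 1) = 1)
    {a b : ℝ} (hab : a ≤ b) {j : ℕ} (hj : j ≤ k)
    (h : ¬(Int.fract a ∈ Set.Icc (r j) (r (j + 1)) ↔ Int.fract b ∈ Set.Icc (r j) (r (j + 1)))) :
    ∃ i ≤ k, ∃ m : ℤ, r i + m ∈ Set.Icc a b := by
  by_contra! hno
  have hfloor : ⌊a⌋ = ⌊b⌋ := by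
    refine le_antisymm (Int.floor_le_floor hab) (not_lt.1 fun hlt => ?_)
    exact hno 0 (Nat.zero_le k) ⌊b⌋
      ⟨by simpa [hr0] using (Int.floor_lt.1 hlt).le, by simpa [hr0] using Int.floor_le b⟩
  have hfract : Int.fract a ≤ Int.fract b := by
    rw [Int.fract, Int.fract, hfloor]; linarith
  have key : ∀ i ≤ k, r i ≤ Int.fract b → r i < Int.fract a := by
    intro i hi hb
    by_contra! ha
    refine hno i hi ⌊a⌋ ⟨?_, ?_⟩
    · rw [Int.fract] at ha; linarith
    · rw [Int.fract, ← hfloor] at hb; linarith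
  apply h
  constructor
  · rintro ⟨h1, h2⟩
    refine ⟨h1.trans hfract, ?_⟩
    rcases hj.eq_or_lt with rfl | hlt
    · rw [hrtop]; exact (Int.fract_lt_one b).le
    · by_contra! hb
      exact (key (j + 1) hlt hb.le).not_ge h2
  · rintro ⟨h1, h2⟩
    exact ⟨(key j hj h1).le, hfract.trans h2⟩

/-- The symmetric form of `exists_breakpoint_mem_Icc`. -/
theorem exists_breakpoint_mem_uIcc {k : ℕ} {r : ℕ → ℝ} (hr0 : r 0 = 0) (hrtop : r (k + 1) = 1)
    {a b : ℝ} {j : ℕ} (hj : j ≤ k)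
    (h : ¬(Int.fract a ∈ Set.Icc (r j) (r (j + 1)) ↔ Int.fract b ∈ Set.Icc (r j) (r (j + 1)))) :
    ∃ i ≤ k, ∃ m : ℤ, r i + m ∈ Set.uIcc a b := by
  rcases le_total a b with hab | hba
  · rw [Set.uIcc_of_le hab]
    exact exists_breakpoint_mem_Icc hr0 hrtop hab hj h
  · rw [Set.uIcc_of_ge hba]
    exact exists_breakpoint_mem_Icc hr0 hrtop hba hj fun h' => h h'.symm

/-- If `M * p` falls, modulo `q`, into one of `k + 1` windows of `w + 1` consecutive integers for
every `M ∈ S ⊆ [0, q)`, where `p` is coprime to `q`, then `S` has at most `(k + 1) * (w + 1)`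
elements. -/
theorem ncard_le_of_forall_exists_dvd {q k w : ℕ} {p : ℤ} (hpq : IsCoprime (q : ℤ) p)
    (b : ℕ → ℤ) {S : Set ℕ}
    (hS : ∀ M ∈ S, M < q ∧ ∃ i ≤ k, ∃ t ≤ w, (q : ℤ) ∣ b i + (t : ℤ) - M * p) :
    S.ncard ≤ (k + 1) * (w + 1) := by
  have hex : ∀ M : ℕ, ∃ x : ℕ × ℕ,
      M ∈ S → x.1 ≤ k ∧ x.2 ≤ w ∧ (q : ℤ) ∣ b x.1 + (x.2 : ℤ) - M * p := by
    intro M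
    by_cases hM : M ∈ S
    · obtain ⟨-, i, hi, t, ht, hd⟩ := hS M hM
      exact ⟨(i, t), fun _ => ⟨hi, ht, hd⟩⟩
    · exact ⟨(0, 0), fun h => absurd h hM⟩
  choose f hf using hex
  have hcard := Set.ncard_le_ncard_of_injOn
    (t := (↑(Finset.range (k + 1) ×ˢ Finset.range (w + 1)) : Set (ℕ × ℕ))) f
    (fun M hM => by
      have h := hf M hM
      simpa [Nat.lt_succ_iff] using ⟨h.1, h.2.1⟩)
    (fun M hM M' hM' heq => by
      have h1 := (hf M hM).2.2
      have h2 := (hf M' hM').2.2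
      rw [← heq] at h2
      have h3 : (q : ℤ) ∣ p * ((M : ℤ) - M') := by
        have := dvd_sub h2 h1
        ring_nf at this ⊢
        exact this
      have h4 : M ≡ M' [MOD q] :=
        (Nat.modEq_iff_dvd.2 (hpq.dvd_of_dvd_mul_left h3)).symm
      exact Nat.ModEq.eq_of_lt_of_lt h4 (hS M hM).1 (hS M' hM').1)
    (Finset.finite_toSet _)
  rwa [Set.ncard_coe_finset, Finset.card_product, Finset.card_range, Finset.card_range] at hcard

namespace GenContFract

/-- The continuants of the regular continued fraction of a real number are integers. -/
theorem exists_int_contsAux_eq (θ : ℝ) (n : ℕ) :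
    ∃ A B : ℤ, (GenContFract.of θ).contsAux n = ⟨(A : ℝ), (B : ℝ)⟩ := by
  induction n using Nat.strong_induction_on with
  | _ n ih =>
    match n with
    | 0 => exact ⟨1, 0, by simp [contsAux]⟩
    | 1 => exact ⟨⌊θ⌋, 1, by simp [contsAux]⟩
    | n + 2 =>
      obtain ⟨A, B, h⟩ := ih n (by omega)
      obtain ⟨A', B', h'⟩ := ih (n + 1) (by omega)
      cases hs : (GenContFract.of θ).s.get? n with
      | none =>
        refine ⟨A', B', ?_⟩
        rw [← h']
        exact contsAux_stable_step_of_terminated hs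
      | some gp =>
        obtain ⟨ha, z, hb⟩ := of_partNum_eq_one_and_exists_int_partDen_eq hs
        refine ⟨z * A' + A, z * B' + B, ?_⟩
        rw [contsAux_recurrence hs h h', ha, hb]
        push_cast
        simp

theorem exists_int_nums_eq (θ : ℝ) (n : ℕ) : ∃ A : ℤ, (GenContFract.of θ).nums n = A := by
  obtain ⟨A, B, h⟩ := exists_int_contsAux_eq θ (n + 1)
  exact ⟨A, by rw [num_eq_conts_a, nth_cont_eq_succ_nth_contAux, h]⟩

theorem exists_int_dens_eq (θ : ℝ) (n : ℕ) : ∃ B : ℤ, (GenContFract.of θ).dens n = B := by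
  obtain ⟨A, B, h⟩ := exists_int_contsAux_eq θ (n + 1)
  exact ⟨B, by rw [den_eq_conts_b, nth_cont_eq_succ_nth_contAux, h]⟩

theorem not_terminatedAt_of_irrational {θ : ℝ} (hθ : Irrational θ) (n : ℕ) :
    ¬(GenContFract.of θ).TerminatedAt n := fun h => by
  obtain ⟨x, hx⟩ := (terminates_iff_rat θ).1 ⟨n, h⟩
  exact hθ ⟨x, hx.symm⟩

/-- A convergent denominator `q` of an irrational `θ` comes with a coprime numerator `p` such that
`|q * θ - p| ≤ 1 / q`. -/
theorem exists_isCoprime_abs_sub_le {θ : ℝ} (hθ : Irrational θ) {n q : ℕ}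
    (hq : (q : ℝ) = (GenContFract.of θ).dens n) :
    ∃ p : ℤ, IsCoprime (q : ℤ) p ∧ (q : ℝ) * |q * θ - p| ≤ 1 := by
  have hnt := not_terminatedAt_of_irrational hθ n
  obtain ⟨p, hp⟩ := exists_int_nums_eq θ n
  obtain ⟨p', hp'⟩ := exists_int_nums_eq θ (n + 1)
  obtain ⟨q', hq'⟩ := exists_int_dens_eq θ (n + 1)
  have hdet : p * q' - q * p' = (-1) ^ (n + 1) := by
    have := SimpContFract.determinant (s := SimpContFract.of θ) hnt
    change (GenContFract.of θ).nums n * (GenContFract.of θ).dens (n + 1) -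
      (GenContFract.of θ).dens n * (GenContFract.of θ).nums (n + 1) = _ at this
    rw [hp, hp', hq', ← hq] at this
    exact_mod_cast this
  have hsq : ((-1 : ℤ) ^ (n + 1)) * (-1) ^ (n + 1) = 1 := by
    rw [← mul_pow]; simp
  refine ⟨p, ⟨-p' * (-1) ^ (n + 1), q' * (-1) ^ (n + 1), ?_⟩, ?_⟩
  · linear_combination (-1 : ℤ) ^ (n + 1) * hdet + hsq
  · have hle := abs_sub_convs_le hnt
    have hmono : (GenContFract.of θ).dens n ≤ (GenContFract.of θ).dens (n + 1) := of_den_mono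
    rw [conv_eq_num_div_den, hp, ← hq] at hle
    rw [← hq] at hmono
    rcases Nat.eq_zero_or_pos q with rfl | hpos
    · simp
    have hq0 : (0 : ℝ) < q := by exact_mod_cast hpos
    have hmul : (q : ℝ) * |q * θ - p| = q * q * |θ - p / q| := by
      have : (q : ℝ) * θ - p = q * (θ - p / q) := by field_simp
      rw [this, abs_mul, abs_of_pos hq0, mul_assoc]
    rw [hmul]
    calc (q : ℝ) * q * |θ - p / q|
        ≤ q * q * (1 / (q * (GenContFract.of θ).dens (n + 1))) := by gcongr
      _ ≤ q * q * (1 / (q * q)) := by gcongr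
      _ = 1 := by field_simp

end GenContFract

/-- A real `c` whose distance above an integer `z` is less than `w + 1` determines a window of
`w + 1` integers containing `z`. -/
theorem Int.exists_le_floor_sub_add_eq {c : ℝ} {z : ℤ} {w : ℕ} (h0 : (z : ℝ) ≤ c)
    (h1 : c < z + (w + 1)) : ∃ t ≤ w, ⌊c⌋ - (w : ℤ) + (t : ℤ) = z := by
  have h2 : z ≤ ⌊c⌋ := Int.le_floor.2 h0
  have h3 : ⌊c⌋ < z + (w + 1) := Int.floor_lt.2 (by push_cast; exact h1)
  exact ⟨(z - ⌊c⌋ + w).toNat, by omega, by omega⟩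

/-- The mirror image of `Int.exists_le_floor_sub_add_eq`. -/
theorem Int.exists_le_ceil_add_eq {c : ℝ} {z : ℤ} {w : ℕ} (h0 : c ≤ z)
    (h1 : (z : ℝ) < c + (w + 1)) : ∃ t ≤ w, ⌈c⌉ + (t : ℤ) = z := by
  have h2 : ⌈c⌉ ≤ z := Int.ceil_le.2 h0
  have h3 : z - (w + 1) < ⌈c⌉ := Int.lt_ceil.2 (by push_cast; linarith)
  exact ⟨(z - ⌈c⌉).toNat, by omega, by omega⟩

theorem mul_lt_one_of_lt_of_mul_le_one {x y ε : ℝ} (hε : 0 ≤ ε) (hxy : x < y) (h : y * ε ≤ 1) :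
    x * ε < 1 := by
  rcases hε.eq_or_lt with rfl | hpos
  · simp
  · exact (mul_lt_mul_of_pos_right hxy hpos).trans_le h

/-- A real `y` between `M * θ + ℓ₁ * ε` and `M * θ + ℓ₂ * ε`, where `ε = q * θ - p`,
confines `q * y - M * p` to `[0, w + 1)`. -/
theorem mul_sub_mem_of_mem_uIcc {θ y ε : ℝ} {p : ℤ} {q M w ℓ₁ ℓ₂ : ℕ} (hMq : M < q)
    (hp : (q : ℝ) * θ - p = ε) (hε : 0 ≤ ε) (hq : q * ε ≤ 1) (h₁ : ℓ₁ ≤ w) (h₂ : ℓ₂ ≤ w)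
    (hy : y ∈ Set.uIcc (M * θ + ℓ₁ * ε) (M * θ + ℓ₂ * ε)) :
    0 ≤ q * y - M * p ∧ q * y - M * p < w + 1 := by
  have hq0 : (0 : ℝ) ≤ q := Nat.cast_nonneg q
  have hM : (M : ℝ) * ε < 1 := mul_lt_one_of_lt_of_mul_le_one hε (by exact_mod_cast hMq) hq
  have hM0 : 0 ≤ (M : ℝ) * ε := by positivity
  have hw : (q : ℝ) * (w * ε) ≤ w := by
    nlinarith [mul_le_mul_of_nonneg_left hq (Nat.cast_nonneg (α := ℝ) w)]
  have hsub : Set.uIcc (M * θ + ℓ₁ * ε) (M * θ + ℓ₂ * ε) ⊆ Set.Icc (M * θ) (M * θ + w * ε) := by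
    have h₁' : (ℓ₁ : ℝ) ≤ w := by exact_mod_cast h₁
    have h₂' : (ℓ₂ : ℝ) ≤ w := by exact_mod_cast h₂
    refine Set.uIcc_subset_Icc ⟨?_, ?_⟩ ⟨?_, ?_⟩
    · have : 0 ≤ (ℓ₁ : ℝ) * ε := by positivity
      linarith
    · gcongr
    · have : 0 ≤ (ℓ₂ : ℝ) * ε := by positivity
      linarith
    · gcongr
  obtain ⟨hl, hu⟩ := hsub hy
  have hl' := mul_le_mul_of_nonneg_left hl hq0
  have hu' := mul_le_mul_of_nonneg_left hu hq0
  have hθ : (q : ℝ) * (M * θ) = M * p + M * ε := by rw [← hp]; ring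
  constructor <;> linarith


/-- Whether the fractional part of `n·θ` lies in `[r i, r (i+1)]`
(the `i`-th component of the coding `δ(n)`). -/
def deltaP (θ : ℝ) (r : ℕ → ℝ) (n i : ℕ) : Prop :=
  Int.fract ((n : ℝ) * θ) ∈ Set.Icc (r i) (r (i + 1))

theorem stmt17
    (θ : ℝ) (hθ : Irrational θ) (hθpos : 0 < θ)
    (k : ℕ) (hk : 1 ≤ k)
    (r : ℕ → ℝ) (hr0 : r 0 = 0) (hrtop : r (k + 1) = 1)
    (hrmono : ∀ i ≤ k, r i < r (i + 1))
    (η : ℝ) (hη : IsLeast {x : ℝ | ∃ i ≤ k, x = r (i + 1) - r i} η)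
    (w : ℕ) (hw : 1 ≤ w)
    (N : ℕ) (qN : ℕ) (hqN : (qN : ℝ) = (GenContFract.of θ).dens N)
    (hbig : 2 * ((w : ℝ) + 1) / η < (qN : ℝ)) :
    {M : ℕ | 1 ≤ M ∧ M < qN ∧
      ∃ ℓ₁ ℓ₂ : ℕ, ℓ₁ < ℓ₂ ∧ ℓ₂ ≤ w ∧
        ∃ i ≤ k, ¬(deltaP θ r (M + ℓ₁ * qN) i ↔ deltaP θ r (M + ℓ₂ * qN) i)}.ncard
      ≤ 2 * k * (w + 1) := by
  obtain ⟨p, hcop, happ⟩ := GenContFract.exists_isCoprime_abs_sub_le hθ hqN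
  have hfract : ∀ M ℓ : ℕ, Int.fract (((M + ℓ * qN : ℕ) : ℝ) * θ) =
      Int.fract ((M : ℝ) * θ + ℓ * (qN * θ - p)) := by
    intro M ℓ
    rw [← Int.fract_sub_intCast _ ((ℓ : ℤ) * p)]
    congr 1
    push_cast
    ring
  refine le_trans (b := (k + 1) * (w + 1)) ?_ (Nat.mul_le_mul_right _ (by omega))
  rcases le_total 0 ((qN : ℝ) * θ - p) with hε | hε
  · rw [abs_of_nonneg hε] at happ
    refine ncard_le_of_forall_exists_dvd hcop (fun i => ⌊(qN : ℝ) * r i⌋ - w) ?_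
    rintro M ⟨-, hMq, ℓ₁, ℓ₂, hlt, hle, j, hj, hne⟩
    simp only [deltaP, hfract] at hne
    obtain ⟨i, hi, m, hm⟩ := exists_breakpoint_mem_uIcc hr0 hrtop hj hne
    obtain ⟨hl, hu⟩ := mul_sub_mem_of_mem_uIcc hMq rfl hε happ (hlt.le.trans hle) hle hm
    obtain ⟨t, ht, hz⟩ := Int.exists_le_floor_sub_add_eq (c := qN * r i) (z := M * p - qN * m)
      (w := w) (by push_cast; linarith) (by push_cast; linarith)
    exact ⟨hMq, i, hi, t, ht, -m, by linear_combination hz⟩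
  · rw [abs_of_nonpos hε] at happ
    refine ncard_le_of_forall_exists_dvd hcop (fun i => ⌈(qN : ℝ) * r i⌉) ?_
    rintro M ⟨-, hMq, ℓ₁, ℓ₂, hlt, hle, j, hj, hne⟩
    simp only [deltaP, hfract] at hne
    obtain ⟨i, hi, m, hm⟩ := exists_breakpoint_mem_uIcc hr0 hrtop hj hne
    have hm' : -(r i + m) ∈ Set.uIcc ((M : ℝ) * -θ + ℓ₁ * -(qN * θ - p))
        (M * -θ + ℓ₂ * -(qN * θ - p)) := by
      rw [← Set.neg_mem_neg, Set.neg_uIcc] at hm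
      have hneg : ∀ ℓ : ℕ, (M : ℝ) * -θ + ℓ * -(qN * θ - p) = -(M * θ + ℓ * (qN * θ - p)) :=
        fun ℓ => by ring
      rwa [hneg, hneg]
    obtain ⟨hl, hu⟩ := mul_sub_mem_of_mem_uIcc (p := -p) hMq (by push_cast; ring)
      (neg_nonneg.2 hε) happ (hlt.le.trans hle) hle hm'
    push_cast at hl hu
    obtain ⟨t, ht, hz⟩ := Int.exists_le_ceil_add_eq (c := qN * r i) (z := M * p - qN * m)
      (w := w) (by push_cast; linarith) (by push_cast; linarith)
    exact ⟨hMq, i, hi, t, ht, -m, by linear_combination hz⟩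
end
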